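/- Let b ≥ 1 and d ≥ 1 be integers, and let G be the graph with vertex set {v_1, …, v_{2b}} ∪ {x_1, …, x_{d−1}} and edge set {{v_i, v_j} : 1 ≤ i < j ≤ 2b} ∪ {{v_1, x_k} : 1 ≤ k ≤ d − 1} (a complete graph K_{2b} together with d − 1 pendant vertices attached to v_1). Then G is connected, ind-match(G) = 1, min-match(G) = match(G) = b, and dim(G) = d. -/

import Mathlib

/-!
Formalization of results from "Matching numbers and dimension of edge ideals"
by A. Hirano and K. Matsuda.

For a finite simple graph `G`:
* a matching is a set of pairwise disjoint edges;
* a maximal matching is one that cannot be enlarged by any edge;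
* an induced matching is a matching such that no edge of `G` meets two
  distinct edges of the matching;
* `matchNum`, `minMatchNum`, `indMatchNum` are the corresponding maximum,
  minimum-maximal and maximum-induced sizes;
* `graphDim K G` is the Krull dimension of `K[V(G)]/I(G)`, where `I(G)` is
  the edge ideal of `G`.
-/

open MvPolynomial
open scoped Classical

noncomputable section

namespace EdgeIdealPaper

variable {V : Type*}

/-- `M` is a matching of `G`: a set of pairwise disjoint edges of `G`. -/
def IsMatching (G : SimpleGraph V) (M : Finset (Sym2 V)) : Prop :=
  (M : Set (Sym2 V)) ⊆ G.edgeSet ∧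
    ∀ e ∈ M, ∀ f ∈ M, e ≠ f → ∀ v : V, v ∈ e → v ∉ f

/-- `M` is a maximal matching of `G`: no edge of `G` outside `M` can be added. -/
def IsMaximalMatching (G : SimpleGraph V) (M : Finset (Sym2 V)) : Prop :=
  IsMatching G M ∧ ∀ e ∈ G.edgeSet, e ∉ M → ¬ IsMatching G (insert e M)

/-- `M` is an induced matching of `G`: a matching such that no edge of `G`
meets two distinct edges of `M`. -/
def IsInducedMatching (G : SimpleGraph V) (M : Finset (Sym2 V)) : Prop :=
  IsMatching G M ∧ ∀ e ∈ G.edgeSet, ∀ f ∈ M, ∀ g ∈ M, f ≠ g →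
    ¬ ((∃ v : V, v ∈ e ∧ v ∈ f) ∧ (∃ v : V, v ∈ e ∧ v ∈ g))

/-- The matching number `match(G)`: maximum size of a matching of `G`. -/
def matchNum (G : SimpleGraph V) : ℕ :=
  sSup {n | ∃ M : Finset (Sym2 V), IsMatching G M ∧ M.card = n}

/-- The minimum matching number `min-match(G)`:
minimum size of a maximal matching of `G`. -/
def minMatchNum (G : SimpleGraph V) : ℕ :=
  sInf {n | ∃ M : Finset (Sym2 V), IsMaximalMatching G M ∧ M.card = n}

/-- The induced matching number `ind-match(G)`:
maximum size of an induced matching of `G`. -/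
def indMatchNum (G : SimpleGraph V) : ℕ :=
  sSup {n | ∃ M : Finset (Sym2 V), IsInducedMatching G M ∧ M.card = n}

/-- The edge ideal `I(G) ⊆ K[x_v : v ∈ V]`, generated by the products
`x_i * x_j` over the edges `{x_i, x_j}` of `G`. -/
def edgeIdeal (K : Type) [Field K] (G : SimpleGraph V) : Ideal (MvPolynomial V K) :=
  Ideal.span {p | ∃ i j : V, G.Adj i j ∧ p = X i * X j}

/-- `dim(G)`: the Krull dimension of the quotient ring `K[V(G)]/I(G)`. -/
def graphDim (K : Type) [Field K] (G : SimpleGraph V) : WithBot ℕ∞ :=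
  ringKrullDim (MvPolynomial V K ⧸ edgeIdeal K G)

/-- The graph of Case 1: a complete graph `K_{2b}` on the vertices
`v_1, …, v_{2b}` (the `Sum.inl` vertices), together with `d - 1` pendant
vertices `x_1, …, x_{d-1}` (the `Sum.inr` vertices) all attached to `v_1`
(the `Sum.inl` vertex with index `0`). -/
def caseOneGraph (b d : ℕ) : SimpleGraph (Fin (2 * b) ⊕ Fin (d - 1)) :=
  SimpleGraph.fromRel (fun u w =>
    (∃ i j : Fin (2 * b), u = Sum.inl i ∧ w = Sum.inl j ∧ i ≠ j) ∨
    (∃ (i : Fin (2 * b)) (k : Fin (d - 1)), (i : ℕ) = 0 ∧ u = Sum.inl i ∧ w = Sum.inr k))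

theorem card_le_graphDim (K : Type) [Field K] (G : SimpleGraph V) [Finite V] {s : Finset V}
    (hs : G.IsIndepSet s) : (s.card : WithBot ℕ∞) ≤ graphDim K G := by
  let f : MvPolynomial V K →ₐ[K] MvPolynomial s K :=
    aeval fun v => if h : v ∈ s then X ⟨v, h⟩ else 0
  have hf : Function.Surjective f := by
    rw [← AlgHom.range_eq_top, eq_top_iff, ← MvPolynomial.adjoin_range_X, Algebra.adjoin_le_iff]
    rintro _ ⟨v, rfl⟩
    exact ⟨X v, by simp [f]⟩
  have hI : ∀ p ∈ edgeIdeal K G, (f : MvPolynomial V K →+* MvPolynomial s K) p = 0 := by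
    intro p hp
    rw [← RingHom.mem_ker]
    refine Ideal.span_le.mpr ?_ hp
    rintro _ ⟨i, j, hij, rfl⟩
    by_cases hi : i ∈ s
    · have hj : j ∉ s := fun hj => hs hi hj hij.ne hij
      simp [f, hj]
    · simp [f, hi]
  have h := ringKrullDim_le_of_surjective (Ideal.Quotient.lift (edgeIdeal K G) _ hI)
    (Ideal.Quotient.lift_surjective_of_surjective _ hI hf)
  simpa [graphDim, MvPolynomial.ringKrullDim_of_isNoetherianRing] using h

theorem ringKrullDim_quotient_span_X_le (K : Type) [Field K] [Finite V] (s : Finset V) :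
    ringKrullDim (MvPolynomial V K ⧸
      Ideal.span ((X : V → MvPolynomial V K) '' (s : Set V)ᶜ)) ≤ (s.card : WithBot ℕ∞) := by
  set J := Ideal.span ((X : V → MvPolynomial V K) '' (s : Set V)ᶜ) with hJ
  let f : MvPolynomial s K →ₐ[K] MvPolynomial V K ⧸ J :=
    (Ideal.Quotient.mkₐ K J).comp (rename Subtype.val)
  have hf : Function.Surjective f := by
    rw [← AlgHom.range_eq_top, eq_top_iff,
      ← (AlgHom.range_eq_top _).mpr (Ideal.Quotient.mkₐ_surjective K J), ← Algebra.map_top,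
      ← MvPolynomial.adjoin_range_X, AlgHom.map_adjoin, Algebra.adjoin_le_iff]
    rintro _ ⟨_, ⟨v, rfl⟩, rfl⟩
    by_cases hv : v ∈ s
    · exact ⟨X ⟨v, hv⟩, by simp [f]⟩
    · refine ⟨0, ?_⟩
      have : (X v : MvPolynomial V K) ∈ J := Ideal.subset_span ⟨v, by simpa using hv, rfl⟩
      simpa using (Ideal.Quotient.eq_zero_iff_mem.mpr this).symm
  have h := ringKrullDim_le_of_surjective (f : MvPolynomial s K →+* MvPolynomial V K ⧸ J) hf
  simpa [MvPolynomial.ringKrullDim_of_isNoetherianRing] using h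

/-- A bound on the sizes of independent sets bounds the dimension: the variables outside a prime
containing the edge ideal form an independent set. -/
theorem graphDim_le (K : Type) [Field K] (G : SimpleGraph V) [Fintype V] {d : ℕ}
    (hd : ∀ s : Finset V, G.IsIndepSet s → s.card ≤ d) :
    graphDim K G ≤ (d : WithBot ℕ∞) := by
  rw [graphDim, ringKrullDim_quotient]
  refine iSup_le fun p => ?_
  let P : PrimeSpectrum (MvPolynomial V K) := p.head.1
  let s : Finset V := Finset.univ.filter fun v => (X v : MvPolynomial V K) ∉ P.asIdeal
  have hs : G.IsIndepSet s := by
    intro i hi j hj _ hij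
    have hmem : (X i * X j : MvPolynomial V K) ∈ P.asIdeal :=
      (PrimeSpectrum.mem_zeroLocus P _).mp p.head.2 (Ideal.subset_span ⟨i, j, hij, rfl⟩)
    rcases P.isPrime.mem_or_mem hmem with h | h
    · exact (Finset.mem_filter.mp hi).2 h
    · exact (Finset.mem_filter.mp hj).2 h
  let J := Ideal.span ((X : V → MvPolynomial V K) '' (s : Set V)ᶜ)
  have hJ : ∀ i, (p i).1 ∈ PrimeSpectrum.zeroLocus (J : Set (MvPolynomial V K)) := by
    intro i
    rw [PrimeSpectrum.mem_zeroLocus]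
    refine (Ideal.span_le.mpr ?_ : J ≤ P.asIdeal).trans (LTSeries.head_le p i)
    rintro _ ⟨v, hv, rfl⟩
    simpa [s] using hv
  let q : LTSeries (PrimeSpectrum.zeroLocus (J : Set (MvPolynomial V K))) :=
    ⟨p.length, fun i => ⟨(p i).1, hJ i⟩, fun i => p.step i⟩
  calc (p.length : WithBot ℕ∞) = q.length := rfl
    _ ≤ Order.krullDim _ := Order.LTSeries.length_le_krullDim q
    _ = ringKrullDim (MvPolynomial V K ⧸ J) := (ringKrullDim_quotient J).symm
    _ ≤ s.card := ringKrullDim_quotient_span_X_le K s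
    _ ≤ d := by exact_mod_cast hd s hs

section Matchings

variable {G : SimpleGraph V} {M : Finset (Sym2 V)}

theorem isMatching_empty : IsMatching G ∅ := by
  simp [IsMatching]

theorem isMatching_singleton {e : Sym2 V} (he : e ∈ G.edgeSet) : IsMatching G {e} := by
  refine ⟨by simpa using he, ?_⟩
  intro e he f hf hne
  rw [Finset.mem_singleton] at he hf
  exact absurd (he.trans hf.symm) hne

theorem isInducedMatching_singleton {e : Sym2 V} (he : e ∈ G.edgeSet) :
    IsInducedMatching G {e} := by
  refine ⟨isMatching_singleton he, ?_⟩
  intro _ _ f hf g hg hne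
  rw [Finset.mem_singleton] at hf hg
  exact absurd (hf.trans hg.symm) hne

theorem IsMatching.insert {e : Sym2 V} (hM : IsMatching G M) (he : e ∈ G.edgeSet)
    (h : ∀ v ∈ e, ∀ f ∈ M, v ∉ f) : IsMatching G (insert e M) := by
  refine ⟨?_, ?_⟩
  · rw [Finset.coe_insert]
    exact Set.insert_subset he hM.1
  · intro f hf g hg hne v hvf hvg
    rcases Finset.mem_insert.mp hf with rfl | hfM <;> rcases Finset.mem_insert.mp hg with rfl | hgM
    · exact hne rfl
    · exact h v hvf g hgM hvg
    · exact h v hvg f hfM hvf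
    · exact hM.2 f hfM g hgM hne v hvf hvg

theorem exists_isMaximalMatching [Finite V] (G : SimpleGraph V) :
    ∃ M : Finset (Sym2 V), IsMaximalMatching G M := by
  have := Fintype.ofFinite V
  obtain ⟨M, hM, hmax⟩ := (Finset.univ.filter (IsMatching G)).exists_max_image Finset.card
    ⟨∅, by simpa using isMatching_empty⟩
  rw [Finset.mem_filter_univ] at hM
  refine ⟨M, hM, fun e _ heM h => ?_⟩
  have := hmax _ ((Finset.mem_filter_univ _).mpr h)
  rw [Finset.card_insert_of_notMem heM] at this
  omega

/-- If all maximal matchings have the size of the largest matchings, both matching numbers equal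
that size. -/
theorem minMatchNum_and_matchNum_eq [Finite V] {b : ℕ}
    (hle : ∀ M, IsMatching G M → M.card ≤ b) (hge : ∀ M, IsMaximalMatching G M → b ≤ M.card) :
    minMatchNum G = b ∧ matchNum G = b := by
  obtain ⟨M, hM⟩ := exists_isMaximalMatching G
  have hMb : M.card = b := (hle M hM.1).antisymm (hge M hM)
  constructor
  · refine IsLeast.csInf_eq ⟨⟨M, hM, hMb⟩, ?_⟩
    rintro _ ⟨N, hN, rfl⟩
    exact hge N hN
  · refine IsGreatest.csSup_eq ⟨⟨M, hM.1, hMb⟩, ?_⟩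
    rintro _ ⟨N, hN, rfl⟩
    exact hle N hN

end Matchings

section CaseOneGraph

variable {b d : ℕ}

@[simp]
theorem caseOneGraph_adj_inl_inl {i j : Fin (2 * b)} :
    (caseOneGraph b d).Adj (Sum.inl i) (Sum.inl j) ↔ i ≠ j := by
  simp [caseOneGraph, eq_comm]

@[simp]
theorem caseOneGraph_adj_inl_inr {i : Fin (2 * b)} {k : Fin (d - 1)} :
    (caseOneGraph b d).Adj (Sum.inl i) (Sum.inr k) ↔ (i : ℕ) = 0 := by
  simp [caseOneGraph]

@[simp]
theorem caseOneGraph_not_adj_inr_inr {k l : Fin (d - 1)} :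
    ¬ (caseOneGraph b d).Adj (Sum.inr k) (Sum.inr l) := by
  simp [caseOneGraph]

theorem caseOneGraph_connected (hb : 1 ≤ b) : (caseOneGraph b d).Connected := by
  let o : Fin (2 * b) := ⟨0, by omega⟩
  refine SimpleGraph.connected_iff_exists_forall_reachable _ |>.mpr ⟨Sum.inl o, ?_⟩
  rintro (i | k)
  · by_cases h : o = i
    · rw [h]
    · exact (caseOneGraph_adj_inl_inl.mpr h).reachable
  · exact (caseOneGraph_adj_inl_inr.mpr rfl).reachable

theorem caseOneGraph_edge_cases {e : Sym2 (Fin (2 * b) ⊕ Fin (d - 1))}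
    (he : e ∈ (caseOneGraph b d).edgeSet) :
    (∃ i j, i ≠ j ∧ e = s(Sum.inl i, Sum.inl j)) ∨
      ∃ (i : Fin (2 * b)) (k : Fin (d - 1)), (i : ℕ) = 0 ∧ e = s(Sum.inl i, Sum.inr k) := by
  induction e with
  | h u w =>
    rw [SimpleGraph.mem_edgeSet] at he
    rcases u with i | k <;> rcases w with j | l
    · exact Or.inl ⟨i, j, by simpa using he, rfl⟩
    · exact Or.inr ⟨i, l, by simpa using he, rfl⟩
    · exact Or.inr ⟨j, k, by simpa using he.symm, Sym2.eq_swap⟩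
    · exact absurd he caseOneGraph_not_adj_inr_inr

theorem caseOneGraph_indMatchNum (hb : 1 ≤ b) : indMatchNum (caseOneGraph b d) = 1 := by
  refine IsGreatest.csSup_eq ⟨⟨{s(Sum.inl (⟨0, by omega⟩ : Fin (2 * b)), Sum.inl ⟨1, by omega⟩)},
    isInducedMatching_singleton (by simp [Fin.ext_iff]), Finset.card_singleton _⟩, ?_⟩
  rintro _ ⟨M, hM, rfl⟩
  have key : ∀ e ∈ M, ∃ i, Sum.inl i ∈ e := by
    intro e he
    rcases caseOneGraph_edge_cases (hM.1.1 he) with ⟨i, j, _, rfl⟩ | ⟨i, k, _, rfl⟩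
    · exact ⟨i, by simp⟩
    · exact ⟨i, by simp⟩
  refine Finset.card_le_one.mpr fun f hf g hg => by_contra fun hne => ?_
  obtain ⟨i, hi⟩ := key f hf
  obtain ⟨j, hj⟩ := key g hg
  have hij : i ≠ j := by
    rintro rfl
    exact hM.1.2 f hf g hg hne _ hi hj
  exact hM.2 s(Sum.inl i, Sum.inl j) (by simpa using hij) f hf g hg hne
    ⟨⟨_, by simp, hi⟩, ⟨_, by simp, hj⟩⟩

/-- The endpoints of an edge of `caseOneGraph b d`, with all pendant vertices identified. -/
def collapsedEndpoints (e : Sym2 (Fin (2 * b) ⊕ Fin (d - 1))) : Finset (Option (Fin (2 * b))) :=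
  (e.map (Sum.elim some fun _ => none)).toFinset

theorem some_mem_collapsedEndpoints {e : Sym2 (Fin (2 * b) ⊕ Fin (d - 1))} {i : Fin (2 * b)} :
    some i ∈ collapsedEndpoints e ↔ Sum.inl i ∈ e := by
  simp [collapsedEndpoints, Sym2.mem_map]

theorem card_collapsedEndpoints {e : Sym2 (Fin (2 * b) ⊕ Fin (d - 1))}
    (he : e ∈ (caseOneGraph b d).edgeSet) : (collapsedEndpoints e).card = 2 := by
  refine Sym2.card_toFinset_of_not_isDiag _ ?_
  rcases caseOneGraph_edge_cases he with ⟨i, j, hij, rfl⟩ | ⟨i, k, _, rfl⟩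
  · simpa using hij
  · simp

theorem disjoint_collapsedEndpoints (hb : 1 ≤ b) {M : Finset (Sym2 (Fin (2 * b) ⊕ Fin (d - 1)))}
    (hM : IsMatching (caseOneGraph b d) M) :
    (M : Set (Sym2 (Fin (2 * b) ⊕ Fin (d - 1)))).PairwiseDisjoint collapsedEndpoints := by
  intro e he f hf hne
  have hnone : ∀ e ∈ M, none ∈ collapsedEndpoints e → Sum.inl ⟨0, by omega⟩ ∈ e := by
    intro e he h
    rcases caseOneGraph_edge_cases (hM.1 he) with ⟨i, j, hij, rfl⟩ | ⟨i, k, hi, rfl⟩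
    · simp [collapsedEndpoints] at h
    · simp [Fin.ext_iff, hi]
  refine Finset.disjoint_left.mpr ?_
  rintro (_ | i) hxe hxf
  · exact hM.2 e he f hf hne _ (hnone e he hxe) (hnone f hf hxf)
  · exact hM.2 e he f hf hne _ (some_mem_collapsedEndpoints.mp hxe)
      (some_mem_collapsedEndpoints.mp hxf)

theorem card_biUnion_collapsedEndpoints (hb : 1 ≤ b)
    {M : Finset (Sym2 (Fin (2 * b) ⊕ Fin (d - 1)))} (hM : IsMatching (caseOneGraph b d) M) :
    (M.biUnion collapsedEndpoints).card = M.card * 2 := by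
  rw [Finset.card_biUnion (disjoint_collapsedEndpoints hb hM)]
  exact Finset.sum_const_nat fun e he => card_collapsedEndpoints (hM.1 he)

theorem IsMatching.card_le_of_caseOneGraph (hb : 1 ≤ b)
    {M : Finset (Sym2 (Fin (2 * b) ⊕ Fin (d - 1)))} (hM : IsMatching (caseOneGraph b d) M) :
    M.card ≤ b := by
  have h := Finset.card_le_univ (M.biUnion collapsedEndpoints)
  rw [card_biUnion_collapsedEndpoints hb hM, Fintype.card_option, Fintype.card_fin] at h
  omega

theorem IsMaximalMatching.le_card_of_caseOneGraph (hb : 1 ≤ b)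
    {M : Finset (Sym2 (Fin (2 * b) ⊕ Fin (d - 1)))}
    (hM : IsMaximalMatching (caseOneGraph b d) M) : b ≤ M.card := by
  set U := M.biUnion collapsedEndpoints with hU
  have hone : (Finset.univ.filter fun i => some i ∉ U).card ≤ 1 := by
    refine Finset.card_le_one.mpr fun i hi j hj => by_contra fun hij => ?_
    have hi' : ∀ e ∈ M, Sum.inl i ∉ e := by
      simpa [hU, some_mem_collapsedEndpoints] using hi
    have hj' : ∀ e ∈ M, Sum.inl j ∉ e := by
      simpa [hU, some_mem_collapsedEndpoints] using hj
    have he : s(Sum.inl i, Sum.inl j) ∈ (caseOneGraph b d).edgeSet := by simpa using hij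
    refine hM.2 _ he (fun h => hi' _ h (by simp)) (hM.1.insert he ?_)
    intro v hv
    rcases Sym2.mem_iff.mp hv with rfl | rfl
    · exact hi'
    · exact hj'
  have hsub : (Finset.univ.filter fun i => some i ∈ U).map .some ⊆ U := by
    intro x hx
    obtain ⟨i, hi, rfl⟩ := Finset.mem_map.mp hx
    exact (Finset.mem_filter.mp hi).2
  have hcard := Finset.card_le_card hsub
  have hsplit := Finset.card_filter_add_card_filter_not (s := Finset.univ)
    fun i : Fin (2 * b) => some i ∈ U
  rw [Finset.card_map, card_biUnion_collapsedEndpoints hb hM.1] at hcard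
  rw [Finset.card_univ, Fintype.card_fin] at hsplit
  omega

theorem card_le_of_isIndepSet_caseOneGraph (hd : 1 ≤ d) {s : Finset (Fin (2 * b) ⊕ Fin (d - 1))}
    (hs : (caseOneGraph b d).IsIndepSet s) : s.card ≤ d := by
  have hl : s.toLeft.card ≤ 1 := by
    refine Finset.card_le_one.mpr fun i hi j hj => by_contra fun hij => ?_
    exact hs (Finset.mem_toLeft.mp hi) (Finset.mem_toLeft.mp hj) (by simpa using hij)
      (by simpa using hij)
  have hr := Finset.card_le_univ s.toRight
  rw [Fintype.card_fin] at hr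
  have := s.card_toLeft_add_card_toRight
  omega

theorem exists_isIndepSet_caseOneGraph (hb : 1 ≤ b) (hd : 1 ≤ d) :
    ∃ s : Finset (Fin (2 * b) ⊕ Fin (d - 1)),
      (caseOneGraph b d).IsIndepSet s ∧ s.card = d := by
  refine ⟨({⟨1, by omega⟩} : Finset (Fin (2 * b))).disjSum Finset.univ, ?_, ?_⟩
  · rintro (i | k) hi (j | l) hj hne h
    · simp_all
    · simp_all
    · have := h.symm
      simp_all
    · exact caseOneGraph_not_adj_inr_inr h
  · rw [Finset.card_disjSum, Finset.card_singleton, Finset.card_univ, Fintype.card_fin]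
    omega

theorem caseOneGraph_graphDim (hb : 1 ≤ b) (hd : 1 ≤ d) (K : Type) [Field K] :
    graphDim K (caseOneGraph b d) = (d : WithBot ℕ∞) := by
  refine (graphDim_le K _ fun s hs => card_le_of_isIndepSet_caseOneGraph hd hs).antisymm ?_
  obtain ⟨s, hs, hcard⟩ := exists_isIndepSet_caseOneGraph hb hd
  simpa [hcard] using card_le_graphDim K _ hs

end CaseOneGraph

/-- For `b ≥ 1` and `d ≥ 1`, the graph `caseOneGraph b d` is connected and has
`ind-match = 1`, `min-match = match = b` and `dim = d`. -/
theorem caseOneGraph_invariants (b d : ℕ) (hb : 1 ≤ b) (hd : 1 ≤ d)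
    (K : Type) [Field K] :
    (caseOneGraph b d).Connected ∧ indMatchNum (caseOneGraph b d) = 1 ∧
      minMatchNum (caseOneGraph b d) = b ∧ matchNum (caseOneGraph b d) = b ∧
      graphDim K (caseOneGraph b d) = (d : WithBot ℕ∞) := by
  obtain ⟨hmin, hmatch⟩ := minMatchNum_and_matchNum_eq (G := caseOneGraph b d)
    (fun _ hM => hM.card_le_of_caseOneGraph hb) (fun _ hM => hM.le_card_of_caseOneGraph hb)
  exact ⟨caseOneGraph_connected hb, caseOneGraph_indMatchNum hb, hmin, hmatch,
    caseOneGraph_graphDim hb hd K⟩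

end EdgeIdealPaper
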